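/- (Slice-energy derivative identity along the singular directions.) Let n ≥ 5 and write ℝⁿ = ℝ⁴ × ℝ^{n−4} with coordinates (x,y); capital indices I run over all n coordinate directions, lowercase unbarred indices j run over the 4 x-directions, and barred indices j̄, k̄ run over the n−4 y-directions. Let Γ be a smooth solution of the Yang–Mills flow on ℝⁿ × I', let φ ∈ C_c^∞(ℝ⁴), δ₀ > 0 and t with [t−δ₀², t] ⊂ I'. Then for every barred index k̄ and every y ∈ ℝ^{n−4}: ∂/∂y_{k̄} [ ∫_{t−δ₀²}^{t} ∫_{ℝ⁴} φ(x)² Σ_{I,J} tr( (F_s)_{IJ} (F_s)_{IJ} )(x,y) dx ds ] = 4 ∫_{t−δ₀²}^{t} ∫_{ℝ⁴} Σ_I tr( ( Σ_{j} ∂_j(φ²)(x) (F_s)_{Ij} − φ(x)² (∂_sΓ_s)_I ) (F_s)_{k̄I} )(x,y) dx ds − 4 Σ_{j̄} ∂/∂y_{j̄} [ ∫_{t−δ₀²}^{t} ∫_{ℝ⁴} φ(x)² Σ_I tr( (F_s)_{Ij̄} (F_s)_{k̄I} )(x,y) dx ds ]. -/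

import Mathlib

open MeasureTheory Filter Set
open scoped ContDiff ENNReal

noncomputable section

abbrev Mat (k : ℕ) := Fin k → Fin k → ℝ

def mmul {k : ℕ} (A B : Mat k) : Mat k := fun i j => ∑ l, A i l * B l j

def mbra {k : ℕ} (A B : Mat k) : Mat k := mmul A B - mmul B A

def minner {k : ℕ} (A B : Mat k) : ℝ := ∑ i, ∑ j, A i j * B i j

def msq {k : ℕ} (A : Mat k) : ℝ := minner A A

abbrev Conn (n k : ℕ) := ℝ → (Fin n → ℝ) → Fin n → Mat k

/-- Spatial partial derivative in the `i`-th coordinate direction. -/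
def pd {n : ℕ} {E : Type*} [NormedAddCommGroup E] [NormedSpace ℝ E]
    (f : (Fin n → ℝ) → E) (x : Fin n → ℝ) (i : Fin n) : E :=
  fderiv ℝ f x (Pi.single i 1)

/-- Time derivative of a time-dependent connection. -/
def tderiv {n k : ℕ} (Γ : Conn n k) (t : ℝ) (x : Fin n → ℝ) (j : Fin n) : Mat k :=
  deriv (fun s => Γ s x j) t

/-- Curvature `(F_t)_{ij} = ∂_i(Γ_t)_j − ∂_j(Γ_t)_i + [(Γ_t)_i,(Γ_t)_j]`. -/
def curv {n k : ℕ} (Γ : Conn n k) (t : ℝ) (x : Fin n → ℝ) (i j : Fin n) : Mat k :=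
  pd (fun y => Γ t y j) x i - pd (fun y => Γ t y i) x j + mbra (Γ t x i) (Γ t x j)

/-- Covariant derivative `∇_i om = ∂_i om + [(Γ_t)_i, om]`. -/
def covD {n k : ℕ} (Γ : Conn n k) (t : ℝ) (om : (Fin n → ℝ) → Mat k)
    (x : Fin n → ℝ) (i : Fin n) : Mat k :=
  pd om x i + mbra (Γ t x i) (om x)

/-- A smooth time-dependent connection: jointly smooth in `(t,x)`, with values in the
skew-symmetric matrices `𝔤`. -/
def IsSmoothConn {n k : ℕ} (Γ : Conn n k) : Prop :=
  ContDiff ℝ ∞ (fun p : ℝ × (Fin n → ℝ) => Γ p.1 p.2)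
    ∧ ∀ t x i a b, Γ t x i b a = - (Γ t x i a b)

/-- The Yang–Mills flow equation `∂_t(Γ_t)_j = Σᵢ ∇_i(F_t)_{ij}` on a time interval `I`. -/
def IsYMFlowOn {n k : ℕ} (Γ : Conn n k) (I : Set ℝ) : Prop :=
  ∀ t ∈ I, ∀ x j, tderiv Γ t x j = ∑ i, covD Γ t (fun y => curv Γ t y i j) x i

/-- `|F_t|²(x) = Σ_{i,j} |(F_t)_{ij}(x)|²`. -/
def normF2 {n k : ℕ} (Γ : Conn n k) (t : ℝ) (x : Fin n → ℝ) : ℝ :=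
  ∑ i, ∑ j, msq (curv Γ t x i j)

/-- The backwards heat kernel `G_{z₀}(x,t)` based at `z₀ = (x₀,t₀)`. -/
def gauss {n : ℕ} (z0 : (Fin n → ℝ) × ℝ) (x : Fin n → ℝ) (t : ℝ) : ℝ :=
  (4 * Real.pi * (z0.2 - t)) ^ (-(n : ℝ) / 2) *
    Real.exp (-(∑ i, (x i - z0.1 i) ^ 2) / (4 * (z0.2 - t)))

/-- The entropy `Φ_{z₀}(R;Γ)`. -/
def Phi {n k : ℕ} (Γ : Conn n k) (z0 : (Fin n → ℝ) × ℝ) (R : ℝ) : ℝ :=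
  R ^ 4 / 2 * ∫ x : Fin n → ℝ, normF2 Γ (z0.2 - R ^ 2) x * gauss z0 x (z0.2 - R ^ 2)

/-- The entropy `Ψ_{z₀}(R;Γ)`. -/
def Psi {n k : ℕ} (Γ : Conn n k) (z0 : (Fin n → ℝ) × ℝ) (R : ℝ) : ℝ :=
  R ^ 2 / 2 * ∫ t in Icc (z0.2 - 4 * R ^ 2) (z0.2 - R ^ 2),
    ∫ x : Fin n → ℝ, normF2 Γ t x * gauss z0 x t

/-- The parabolically rescaled connection `Γ^{λ,z₀}`. -/
def rescale {n k : ℕ} (Γ : Conn n k) (z0 : (Fin n → ℝ) × ℝ) (lam : ℝ) : Conn n k :=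
  fun t x i => lam • Γ (lam ^ 2 * t + z0.2) (fun m => lam * x m + z0.1 m) i

/-- Spatial support of `Γ_t` contained in `K` for all `t`. -/
def SuppIn {n k : ℕ} (Γ : Conn n k) (K : Set (Fin n → ℝ)) : Prop :=
  ∀ t x, x ∉ K → Γ t x = 0

/-- Trace of a product of two matrices: `tr(AB)`. -/
def trMul {k : ℕ} (A B : Mat k) : ℝ := ∑ a, ∑ b, A a b * B b a

/-- Embedding of the first four ("unbarred") coordinate directions of `ℝⁿ = ℝ⁴ × ℝ^{n−4}`. -/
def emb4 {n : ℕ} (h : 4 ≤ n) (j : Fin 4) : Fin n := ⟨j.1, by have := j.2; omega⟩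

/-- Embedding of the last `n − 4` ("barred") coordinate directions of `ℝⁿ = ℝ⁴ × ℝ^{n−4}`. -/
def embB {n : ℕ} (j : Fin (n - 4)) : Fin n := ⟨4 + j.1, by have := j.2; omega⟩

/-- The point of `ℝⁿ = ℝ⁴ × ℝ^{n−4}` with coordinates `(x, y)`. -/
def assemble {n : ℕ} (x : Fin 4 → ℝ) (y : Fin (n - 4) → ℝ) : Fin n → ℝ :=
  fun I => if h : I.1 < 4 then x ⟨I.1, h⟩ else y ⟨I.1 - 4, by have := I.2; omega⟩

/-- The matrix commutator as a continuous bilinear map. -/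
def mbraL (k : ℕ) : Mat k →L[ℝ] Mat k →L[ℝ] Mat k :=
  (LinearMap.mk₂ ℝ mbra
    (fun A B C => by
      ext i j; simp [mbra, mmul, add_mul, mul_add, Finset.sum_add_distrib]; ring)
    (fun c A B => by
      ext i j; simp [mbra, mmul, mul_assoc, mul_left_comm, Finset.mul_sum, mul_sub])
    (fun A B C => by
      ext i j; simp [mbra, mmul, add_mul, mul_add, Finset.sum_add_distrib]; ring)
    (fun c A B => by
      ext i j; simp [mbra, mmul, mul_assoc, mul_left_comm, Finset.mul_sum,
        mul_sub])).toContinuousBilinearMap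

/-- The trace pairing as a continuous bilinear map. -/
def trMulL (k : ℕ) : Mat k →L[ℝ] Mat k →L[ℝ] ℝ :=
  (LinearMap.mk₂ ℝ trMul
    (fun A B C => by simp [trMul, add_mul, Finset.sum_add_distrib])
    (fun c A B => by simp [trMul, mul_assoc, Finset.mul_sum])
    (fun A B C => by simp [trMul, mul_add, Finset.sum_add_distrib])
    (fun c A B => by simp [trMul, mul_left_comm, Finset.mul_sum])).toContinuousBilinearMap

theorem mbraL_apply {k : ℕ} (A B : Mat k) : mbraL k A B = mbra A B := rfl

theorem trMulL_apply {k : ℕ} (A B : Mat k) : trMulL k A B = trMul A B := rfl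

theorem trMul_comm {k : ℕ} (A B : Mat k) : trMul A B = trMul B A := by
  unfold trMul
  rw [Finset.sum_comm]
  simp only [mul_comm]

theorem trMul_eq_trace {k : ℕ} (A B : Matrix (Fin k) (Fin k) ℝ) :
    trMul A B = (A * B).trace := by
  simp [trMul, Matrix.trace, Matrix.mul_apply]

theorem mbra_eq_commutator {k : ℕ} (A B : Matrix (Fin k) (Fin k) ℝ) :
    mbra A B = A * B - B * A := by
  ext i j; simp [mbra, mmul, Matrix.mul_apply]

theorem trMul_mbra_add {k : ℕ} (A B C : Mat k) :
    trMul (mbra A B) C + trMul B (mbra A C) = 0 := by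
  have h : ∀ X Y Z : Matrix (Fin k) (Fin k) ℝ,
      trMul (mbra X Y) Z + trMul Y (mbra X Z) = 0 := by
    intro X Y Z
    have e : (X * Y - Y * X) * Z + Y * (X * Z - Z * X) = X * (Y * Z) - Y * Z * X := by
      noncomm_ring
    rw [mbra_eq_commutator, mbra_eq_commutator, trMul_eq_trace, trMul_eq_trace,
      ← Matrix.trace_add, e, Matrix.trace_sub, Matrix.trace_mul_comm, sub_self]
  exact h A B C

theorem mbra_skew {k : ℕ} (A B : Mat k) : mbra A B = - mbra B A := by
  simp [mbra]

theorem mbra_jacobi {k : ℕ} (A B C : Mat k) :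
    mbra A (mbra B C) + mbra B (mbra C A) + mbra C (mbra A B) = 0 := by
  have h : ∀ X Y Z : Matrix (Fin k) (Fin k) ℝ,
      (X * (Y * Z - Z * Y) - (Y * Z - Z * Y) * X) + (Y * (Z * X - X * Z) - (Z * X - X * Z) * Y)
        + (Z * (X * Y - Y * X) - (X * Y - Y * X) * Z) = 0 := by
    intro X Y Z
    noncomm_ring
  have h' : ∀ X Y Z : Matrix (Fin k) (Fin k) ℝ,
      mbra X (mbra Y Z) + mbra Y (mbra Z X) + mbra Z (mbra X Y) = 0 := by
    intro X Y Z
    simp only [mbra_eq_commutator]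
    exact h X Y Z
  exact h' A B C

section PartialDerivatives

variable {n : ℕ} {E F G : Type*} [NormedAddCommGroup E] [NormedSpace ℝ E]
  [NormedAddCommGroup F] [NormedSpace ℝ F] [NormedAddCommGroup G] [NormedSpace ℝ G]

theorem pd_bilinear (B : E →L[ℝ] F →L[ℝ] G) {f : (Fin n → ℝ) → E} {g : (Fin n → ℝ) → F}
    {x : Fin n → ℝ} (hf : DifferentiableAt ℝ f x) (hg : DifferentiableAt ℝ g x) (i : Fin n) :
    pd (fun y => B (f y) (g y)) x i = B (f x) (pd g x i) + B (pd f x i) (g x) := by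
  simp [pd, B.fderiv_of_bilinear hf hg]

theorem pd_add {f g : (Fin n → ℝ) → E} {x : Fin n → ℝ}
    (hf : DifferentiableAt ℝ f x) (hg : DifferentiableAt ℝ g x) (i : Fin n) :
    pd (fun y => f y + g y) x i = pd f x i + pd g x i := by
  simp [pd, fderiv_fun_add hf hg]

theorem pd_sub {f g : (Fin n → ℝ) → E} {x : Fin n → ℝ}
    (hf : DifferentiableAt ℝ f x) (hg : DifferentiableAt ℝ g x) (i : Fin n) :
    pd (fun y => f y - g y) x i = pd f x i - pd g x i := by
  simp [pd, fderiv_fun_sub hf hg]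

theorem pd_neg (f : (Fin n → ℝ) → E) (x : Fin n → ℝ) (i : Fin n) :
    pd (fun y => - f y) x i = - pd f x i := by
  simp [pd, fderiv_fun_neg]

theorem pd_sum {ι : Type*} (s : Finset ι) {f : ι → (Fin n → ℝ) → E} {x : Fin n → ℝ}
    (hf : ∀ a ∈ s, DifferentiableAt ℝ (f a) x) (i : Fin n) :
    pd (fun y => ∑ a ∈ s, f a y) x i = ∑ a ∈ s, pd (f a) x i := by
  simp [pd, fderiv_fun_sum hf]

theorem pd_contDiff {f : (Fin n → ℝ) → E} (hf : ContDiff ℝ ∞ f) (i : Fin n) :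
    ContDiff ℝ ∞ (fun x => pd f x i) :=
  (hf.fderiv_right (m := ∞) (by simp)).clm_apply contDiff_const

theorem pd_comm {f : (Fin n → ℝ) → E} (hf : ContDiff ℝ ∞ f) (x : Fin n → ℝ) (i j : Fin n) :
    pd (fun y => pd f y j) x i = pd (fun y => pd f y i) x j := by
  have hd : DifferentiableAt ℝ (fderiv ℝ f) x :=
    ((hf.fderiv_right (m := ∞) (by simp)).differentiable (by simp)) x
  have key : ∀ a b : Fin n, pd (fun y => pd f y b) x a
      = fderiv ℝ (fderiv ℝ f) x (Pi.single a 1) (Pi.single b 1) := by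
    intro a b
    simp only [pd]
    rw [fderiv_clm_apply hd (differentiableAt_const _)]
    simp
  rw [key, key]
  exact (hf.contDiffAt.isSymmSndFDerivAt (by simpa using WithTop.coe_le_coe.2 (le_top : (2 : ℕ∞) ≤ ⊤))) _ _

theorem pd_slice {f : ℝ × (Fin n → ℝ) → E} (hf : ContDiff ℝ ∞ f) (s : ℝ) (x : Fin n → ℝ)
    (i : Fin n) :
    pd (fun z => f (s, z)) x i = fderiv ℝ f (s, x) (0, Pi.single i 1) := by
  have h := ((hf.differentiable (by simp)) (s, x)).hasFDerivAt.comp x (hasFDerivAt_prodMk_right s x)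
  have h' : HasFDerivAt (fun z => f (s, z)) _ x := h
  simp [pd, h'.fderiv]

theorem pd_slice_contDiff {f : ℝ × (Fin n → ℝ) → E} (hf : ContDiff ℝ ∞ f) (i : Fin n) :
    ContDiff ℝ ∞ (fun p : ℝ × (Fin n → ℝ) => pd (fun z => f (p.1, z)) p.2 i) := by
  simp only [pd_slice hf]
  exact (hf.fderiv_right (m := ∞) (by simp)).clm_apply contDiff_const

end PartialDerivatives

section Curvature

variable {n k : ℕ} {Γ : Conn n k}

theorem IsSmoothConn.component (h : IsSmoothConn Γ) (i : Fin n) :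
    ContDiff ℝ ∞ (fun p : ℝ × (Fin n → ℝ) => Γ p.1 p.2 i) :=
  contDiff_pi.1 h.1 i

theorem IsSmoothConn.slice (h : IsSmoothConn Γ) (t : ℝ) (i : Fin n) :
    ContDiff ℝ ∞ (fun x => Γ t x i) :=
  (h.component i).comp (contDiff_const.prodMk contDiff_id)

theorem IsSmoothConn.curv (h : IsSmoothConn Γ) (i j : Fin n) :
    ContDiff ℝ ∞ (fun p : ℝ × (Fin n → ℝ) => curv Γ p.1 p.2 i j) :=
  ((pd_slice_contDiff (h.component j) i).sub (pd_slice_contDiff (h.component i) j)).add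
    (((mbraL k).contDiff.comp (h.component i)).clm_apply (h.component j))

theorem IsSmoothConn.curv_slice (h : IsSmoothConn Γ) (t : ℝ) (i j : Fin n) :
    ContDiff ℝ ∞ (fun x => _root_.curv Γ t x i j) :=
  (h.curv i j).comp (contDiff_const.prodMk contDiff_id)

theorem IsSmoothConn.tderiv (h : IsSmoothConn Γ) (i : Fin n) :
    ContDiff ℝ ∞ (fun p : ℝ × (Fin n → ℝ) => tderiv Γ p.1 p.2 i) := by
  have key : ∀ p : ℝ × (Fin n → ℝ), _root_.tderiv Γ p.1 p.2 i
      = fderiv ℝ (fun p : ℝ × (Fin n → ℝ) => Γ p.1 p.2 i) p (1, 0) := by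
    rintro ⟨s, x⟩
    have h1 := (((h.component i).differentiable (by simp)) (s, x)).hasFDerivAt.comp
      (f := fun s => (s, x)) s (hasFDerivAt_prodMk_left s x)
    have h2 : HasFDerivAt (fun s => Γ s x i) _ s := h1
    simp [_root_.tderiv, h2.hasDerivAt.deriv]
  simp only [key]
  exact ((h.component i).fderiv_right (m := ∞) (by simp)).clm_apply contDiff_const

theorem curv_skew (Γ : Conn n k) (t : ℝ) (x : Fin n → ℝ) (i j : Fin n) :
    curv Γ t x i j = - curv Γ t x j i := by
  rw [curv, curv, mbra_skew (Γ t x i)]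
  abel

theorem covD_neg (Γ : Conn n k) (t : ℝ) (w : (Fin n → ℝ) → Mat k) (x : Fin n → ℝ) (i : Fin n) :
    covD Γ t (fun y => - w y) x i = - covD Γ t w x i := by
  simp only [covD, pd_neg, ← mbraL_apply, map_neg, neg_add]

theorem covD_curv_skew (Γ : Conn n k) (t : ℝ) (x : Fin n → ℝ) (l i j : Fin n) :
    covD Γ t (fun y => curv Γ t y i j) x l = - covD Γ t (fun y => curv Γ t y j i) x l := by
  rw [← covD_neg]
  simp only [← curv_skew]

theorem pd_trMul (Γ : Conn n k) (t : ℝ) {v w : (Fin n → ℝ) → Mat k} {x : Fin n → ℝ}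
    (hv : DifferentiableAt ℝ v x) (hw : DifferentiableAt ℝ w x) (i : Fin n) :
    pd (fun y => trMul (v y) (w y)) x i
      = trMul (covD Γ t v x i) (w x) + trMul (v x) (covD Γ t w x i) := by
  have h := pd_bilinear (trMulL k) hv hw i
  simp only [trMulL_apply] at h
  rw [h]
  have h2 := trMul_mbra_add (Γ t x i) (v x) (w x)
  simp only [covD, ← trMulL_apply, map_add, add_apply] at h2 ⊢
  linarith

/-- The second Bianchi identity. -/
theorem covD_curv_bianchi (h : IsSmoothConn Γ) (t : ℝ) (x : Fin n → ℝ) (l i j : Fin n) :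
    covD Γ t (fun y => curv Γ t y i j) x l
      = covD Γ t (fun y => curv Γ t y l j) x i - covD Γ t (fun y => curv Γ t y l i) x j := by
  have d : ∀ a, DifferentiableAt ℝ (fun y => Γ t y a) x := fun a =>
    (h.slice t a).differentiable (by simp) x
  have dd : ∀ a b, DifferentiableAt ℝ (fun y => pd (fun z => Γ t z a) y b) x := fun a b =>
    (pd_contDiff (h.slice t a) b).differentiable (by simp) x
  have key : ∀ a b c, covD Γ t (fun y => curv Γ t y a b) x c
      = pd (fun y => pd (fun z => Γ t z b) y a) x c - pd (fun y => pd (fun z => Γ t z a) y b) x c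
        + (mbra (Γ t x a) (pd (fun z => Γ t z b) x c) + mbra (pd (fun z => Γ t z a) x c) (Γ t x b))
        + (mbra (Γ t x c) (pd (fun z => Γ t z b) x a) - mbra (Γ t x c) (pd (fun z => Γ t z a) x b)
          + mbra (Γ t x c) (mbra (Γ t x a) (Γ t x b))) := by
    intro a b c
    have db : DifferentiableAt ℝ (fun y => mbraL k (Γ t y a) (Γ t y b)) x :=
      ((mbraL k).differentiableAt.comp x (d a)).clm_apply (d b)
    have e := pd_bilinear (mbraL k) (d a) (d b) c
    simp only [covD, curv, ← mbraL_apply, map_add, map_sub]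
    rw [pd_add ((dd b a).fun_sub (dd a b)) db, pd_sub (dd b a) (dd a b), e]
  rw [key, key, key, pd_comm (h.slice t j) x l i, pd_comm (h.slice t i) x l j,
    pd_comm (h.slice t l) x i j, mbra_skew (pd (fun z => Γ t z i) x l) (Γ t x j),
    mbra_skew (pd (fun z => Γ t z l) x i) (Γ t x j),
    mbra_skew (pd (fun z => Γ t z l) x j) (Γ t x i)]
  have hj := mbra_jacobi (Γ t x l) (Γ t x i) (Γ t x j)
  have e1 : mbra (Γ t x i) (mbra (Γ t x l) (Γ t x j))
      = - mbra (Γ t x i) (mbra (Γ t x j) (Γ t x l)) := by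
    rw [mbra_skew (Γ t x l), ← mbraL_apply, map_neg]; rfl
  have e2 : mbra (Γ t x l) (mbra (Γ t x i) (Γ t x j))
      = - mbra (Γ t x i) (mbra (Γ t x j) (Γ t x l))
        - mbra (Γ t x j) (mbra (Γ t x l) (Γ t x i)) := by
    rw [← sub_eq_zero, ← hj]; abel
  rw [e1, e2]
  abel

/-- Pointwise form of the identity: conservation law for the stress tensor of the flow. -/
theorem pd_energy_density (h : IsSmoothConn Γ) {I' : Set ℝ} (hflow : IsYMFlowOn Γ I')
    {s : ℝ} (hs : s ∈ I') (z : Fin n → ℝ) (l : Fin n) :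
    pd (fun z => ∑ I, ∑ J, trMul (curv Γ s z I J) (curv Γ s z I J)) z l
      = -4 * (∑ J, pd (fun z => ∑ I, trMul (curv Γ s z I J) (curv Γ s z l I)) z J)
        - 4 * ∑ I, trMul (tderiv Γ s z I) (curv Γ s z l I) := by
  have d : ∀ a b, DifferentiableAt ℝ (fun y => curv Γ s y a b) z := fun a b =>
    (h.curv_slice s a b).differentiable (by simp) z
  have dt : ∀ a b a' b', DifferentiableAt ℝ
      (fun y => trMul (curv Γ s y a b) (curv Γ s y a' b')) z := fun a b a' b' =>
    ((trMulL k).differentiableAt.comp z (d a b)).clm_apply (d a' b')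
  rw [pd_sum _ (fun a _ => DifferentiableAt.fun_sum fun b _ => dt a b a b)]
  simp_rw [pd_sum _ (fun a _ => dt _ a _ a), pd_sum _ (fun a _ => dt a _ l a),
    pd_trMul Γ s (d _ _) (d _ _), hflow s hs]
  set D := fun a b c => covD Γ s (fun y => curv Γ s y b c) z a with hD
  set F := fun a b => curv Γ s z a b with hF
  have hDs : ∀ a b c, D a b c = - D a c b := fun a b c => covD_curv_skew Γ s z a b c
  have hFs : ∀ a b, F a b = - F b a := fun a b => curv_skew Γ s z a b
  have hB : ∀ a b, D l a b = D a l b - D b l a := fun a b => covD_curv_bianchi h s z l a b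
  have nl : ∀ A B : Mat k, trMul (-A) B = - trMul A B := fun A B => by
    simp [← trMulL_apply]
  have nr : ∀ A B : Mat k, trMul A (-B) = - trMul A B := fun A B => by
    simp [← trMulL_apply]
  have sl : ∀ A B C : Mat k, trMul (A - B) C = trMul A C - trMul B C := fun A B C => by
    simp [← trMulL_apply]
  have suml : ∀ (f : Fin n → Mat k) (B : Mat k), trMul (∑ a, f a) B = ∑ a, trMul (f a) B :=
    fun f B => by simp [← trMulL_apply]
  change ∑ a, ∑ b, (trMul (D l a b) (F a b) + trMul (F a b) (D l a b))
    = -4 * ∑ J, ∑ I, (trMul (D J I J) (F l I) + trMul (F I J) (D J l I))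
      - 4 * ∑ I, trMul (∑ i, D i i I) (F l I)
  have c1 : ∑ a, ∑ b, trMul (D b l a) (F a b) = - ∑ a, ∑ b, trMul (D a l b) (F a b) := by
    rw [Finset.sum_comm, ← Finset.sum_neg_distrib]
    refine Finset.sum_congr rfl fun a _ => ?_
    rw [← Finset.sum_neg_distrib]
    refine Finset.sum_congr rfl fun b _ => ?_
    rw [hFs b a, nr]
  have c2 : ∑ J, ∑ I, trMul (D J I J) (F l I) = - ∑ I, trMul (∑ i, D i i I) (F l I) := by
    simp_rw [suml]
    rw [Finset.sum_comm, ← Finset.sum_neg_distrib]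
    refine Finset.sum_congr rfl fun a _ => ?_
    rw [← Finset.sum_neg_distrib]
    refine Finset.sum_congr rfl fun b _ => ?_
    rw [hDs b a b, nl]
  have c3 : ∑ J, ∑ I, trMul (F I J) (D J l I) = - ∑ a, ∑ b, trMul (D a l b) (F a b) := by
    rw [← Finset.sum_neg_distrib]
    refine Finset.sum_congr rfl fun a _ => ?_
    rw [← Finset.sum_neg_distrib]
    refine Finset.sum_congr rfl fun b _ => ?_
    rw [hFs b a, nl, trMul_comm]
  simp_rw [trMul_comm (F _ _) (D l _ _), hB, sl, Finset.sum_add_distrib,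
    Finset.sum_sub_distrib, c1, c2, c3]
  ring

end Curvature

section SliceIntegrals

/-- `assemble` as a continuous linear map. -/
def assembleL (n : ℕ) : (Fin 4 → ℝ) × (Fin (n - 4) → ℝ) →L[ℝ] (Fin n → ℝ) :=
  LinearMap.toContinuousLinearMap
    { toFun := fun p => assemble p.1 p.2
      map_add' := fun p q => by
        ext I; by_cases h : I.1 < 4 <;> simp [assemble, h]
      map_smul' := fun c p => by
        ext I; by_cases h : I.1 < 4 <;> simp [assemble, h] }

theorem assembleL_apply {n : ℕ} (p : (Fin 4 → ℝ) × (Fin (n - 4) → ℝ)) :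
    assembleL n p = assemble p.1 p.2 := rfl

theorem assembleL_single_left {n : ℕ} (h : 4 ≤ n) (j : Fin 4) :
    assembleL n (Pi.single j 1, 0) = Pi.single (emb4 h j) 1 := by
  ext I
  by_cases hI : I.1 < 4
  · simp [assembleL_apply, assemble, hI, emb4, Pi.single_apply, Fin.ext_iff]
  · have : I.1 ≠ j.1 := by have := j.2; omega
    simp [assembleL_apply, assemble, hI, emb4, Fin.ext_iff, this]

theorem assembleL_single_right {n : ℕ} (j : Fin (n - 4)) :
    assembleL n (0, Pi.single j 1) = Pi.single (embB j) 1 := by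
  ext I
  by_cases hI : I.1 < 4
  · have : I.1 ≠ 4 + j.1 := by omega
    simp [assembleL_apply, assemble, hI, embB, Fin.ext_iff, this]
  · have : I.1 - 4 = j.1 ↔ I.1 = 4 + j.1 := by omega
    simp [assembleL_apply, assemble, hI, embB, Pi.single_apply, Fin.ext_iff, this]

theorem sum_eq_sum_emb4_add_sum_embB {n : ℕ} (h : 4 ≤ n) {M : Type*} [AddCommMonoid M]
    (f : Fin n → M) : ∑ I, f I = ∑ j, f (emb4 h j) + ∑ j, f (embB j) := by
  have e : 4 + (n - 4) = n := by omega
  rw [← (finCongr e).sum_comp f, Fin.sum_univ_add]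
  rfl

variable {n : ℕ}

theorem contDiff_slice {h : ℝ × (Fin n → ℝ) → ℝ} (hh : ContDiff ℝ ∞ h) :
    ContDiff ℝ ∞ (fun q : (Fin (n - 4) → ℝ) × (ℝ × (Fin 4 → ℝ)) =>
      h (q.2.1, assemble q.2.2 q.1)) :=
  hh.comp ((contDiff_fst.comp contDiff_snd).prodMk
    ((assembleL n).contDiff.comp ((contDiff_snd.comp contDiff_snd).prodMk contDiff_fst)))

/-- Iterated integrals of continuous functions supported over a compact set. -/
theorem integral_integral_eq_setIntegral {X : Type*} [TopologicalSpace X] [T2Space X]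
    [MeasurableSpace X] [OpensMeasurableSpace X] [SecondCountableTopology X]
    {μ : Measure X} [IsFiniteMeasureOnCompacts μ] [SFinite μ] {K : Set X}
    (hK : IsCompact K) {u : ℝ → X → ℝ} (hu : Continuous (Function.uncurry u))
    (h0 : ∀ s, ∀ x ∉ K, u s x = 0) (a b : ℝ) :
    ∫ s in Icc a b, ∫ x, u s x ∂μ = ∫ p in Icc a b ×ˢ K, u p.1 p.2 ∂(volume.prod μ) := by
  rw [setIntegral_prod (fun p : ℝ × X => u p.1 p.2)
    (hu.continuousOn.integrableOn_compact (isCompact_Icc.prod hK))]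
  refine integral_congr_ae (ae_of_all _ fun s => ?_)
  exact (setIntegral_eq_integral_of_forall_compl_eq_zero (h0 s)).symm

/-- Differentiation under the integral sign over a compact set. -/
theorem hasFDerivAt_setIntegral_of_contDiff {Y X : Type*} [NormedAddCommGroup Y] [NormedSpace ℝ Y]
    [FiniteDimensional ℝ Y] [NormedAddCommGroup X] [NormedSpace ℝ X]
    [MeasurableSpace X] [BorelSpace X] [SecondCountableTopology X]
    {μ : Measure X} [IsFiniteMeasureOnCompacts μ] {K : Set X} (hK : IsCompact K)
    {f : Y × X → ℝ} (hf : ContDiff ℝ 1 f) (y : Y) :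
    HasFDerivAt (fun y => ∫ x in K, f (y, x) ∂μ)
      (∫ x in K, (fderiv ℝ f (y, x)).comp (ContinuousLinearMap.inl ℝ Y X) ∂μ) y := by
  have hc : Continuous fun q : Y × X =>
      (fderiv ℝ f q).comp (ContinuousLinearMap.inl ℝ Y X) :=
    (hf.continuous_fderiv (by simp)).clm_comp continuous_const
  obtain ⟨C, hC⟩ := ((isCompact_closedBall y 1).prod hK).exists_bound_of_continuousOn
    hc.continuousOn
  have : IsFiniteMeasure (μ.restrict K) := ⟨by simpa using hK.measure_lt_top⟩
  refine hasFDerivAt_integral_of_dominated_of_fderiv_le (bound := fun _ => C)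
    (F := fun y x => f (y, x))
    (F' := fun y x => (fderiv ℝ f (y, x)).comp (ContinuousLinearMap.inl ℝ Y X))
    (Metric.closedBall_mem_nhds y one_pos) ?_ ?_ ?_ ?_ (integrable_const C) ?_
  · exact Eventually.of_forall fun z =>
      (hf.continuous.comp (Continuous.prodMk_right z)).aestronglyMeasurable
  · exact (hf.continuous.comp (Continuous.prodMk_right y)).continuousOn.integrableOn_compact hK
  · exact (hc.comp (Continuous.prodMk_right y)).aestronglyMeasurable
  · exact (ae_restrict_mem hK.measurableSet).mono fun x hx z hz => hC (z, x) ⟨hz, hx⟩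
  · exact ae_of_all _ fun x z _ =>
      ((hf.differentiable (by simp)) (z, x)).hasFDerivAt.comp z (hasFDerivAt_prodMk_left z x)

theorem fderiv_slice_integral {h : ℝ × (Fin n → ℝ) → ℝ} (hh : ContDiff ℝ ∞ h)
    {ψ : (Fin 4 → ℝ) → ℝ} (hψ : ContDiff ℝ ∞ ψ) (hψc : HasCompactSupport ψ)
    (a b : ℝ) (y : Fin (n - 4) → ℝ) (l : Fin (n - 4)) :
    fderiv ℝ (fun y' => ∫ s in Icc a b, ∫ x, ψ x * h (s, assemble x y')) y (Pi.single l 1)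
      = ∫ p in Icc a b ×ˢ tsupport ψ,
          ψ p.2 * pd (fun z => h (p.1, z)) (assemble p.2 y) (embB l) := by
  have hK : IsCompact (Icc a b ×ˢ tsupport ψ) := isCompact_Icc.prod hψc
  have hf : ContDiff ℝ ∞ (fun q : (Fin (n - 4) → ℝ) × (ℝ × (Fin 4 → ℝ)) =>
      ψ q.2.2 * h (q.2.1, assemble q.2.2 q.1)) :=
    (hψ.comp (contDiff_snd.comp contDiff_snd)).mul (contDiff_slice hh)
  have e : (fun y' => ∫ s in Icc a b, ∫ x, ψ x * h (s, assemble x y'))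
      = fun y' => ∫ p in Icc a b ×ˢ tsupport ψ, ψ p.2 * h (p.1, assemble p.2 y') := by
    ext y'
    exact integral_integral_eq_setIntegral (u := fun s x => ψ x * h (s, assemble x y')) hψc
      (hf.continuous.comp (Continuous.prodMk_right y'))
      (fun s x hx => by simp [image_eq_zero_of_notMem_tsupport hx]) a b
  have hc : Continuous fun p : ℝ × (Fin 4 → ℝ) =>
      (fderiv ℝ (fun q : (Fin (n - 4) → ℝ) × (ℝ × (Fin 4 → ℝ)) =>
        ψ q.2.2 * h (q.2.1, assemble q.2.2 q.1)) (y, p)).comp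
        (ContinuousLinearMap.inl ℝ (Fin (n - 4) → ℝ) (ℝ × (Fin 4 → ℝ))) :=
    ((hf.continuous_fderiv (by simp)).clm_comp continuous_const).comp (Continuous.prodMk_right y)
  rw [e, (hasFDerivAt_setIntegral_of_contDiff (μ := volume) hK (hf.of_le (by simp)) y).fderiv,
    ContinuousLinearMap.integral_apply (hc.continuousOn.integrableOn_compact hK)]
  refine integral_congr_ae (ae_of_all _ fun p => ?_)
  have h1 := ((hf.differentiable (by simp)) (y, p)).hasFDerivAt.comp
    (f := fun y' => (y', p)) y (hasFDerivAt_prodMk_left y p)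
  have h2 : HasFDerivAt (fun y' => assemble p.2 y')
      ((assembleL n).comp (ContinuousLinearMap.inr ℝ _ _)) y :=
    (assembleL n).hasFDerivAt.comp y (hasFDerivAt_prodMk_right p.2 y)
  have d : Differentiable ℝ (fun z => h (p.1, z)) :=
    (hh.comp (contDiff_const.prodMk contDiff_id)).differentiable (by simp)
  have h3 : HasFDerivAt (fun y' => h (p.1, assemble p.2 y')) _ y :=
    (d (assemble p.2 y)).hasFDerivAt.comp (g := fun z => h (p.1, z)) y h2
  have h4 := h1.unique (h3.const_mul (ψ p.2))
  simp only [h4, pd]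
  simp [assembleL_single_right]

theorem integral_slice_mul_pd {h : ℝ × (Fin n → ℝ) → ℝ} (hh : ContDiff ℝ ∞ h)
    {ψ : (Fin 4 → ℝ) → ℝ} (hψ : ContDiff ℝ ∞ ψ) (hψc : HasCompactSupport ψ)
    (h4 : 4 ≤ n) (s : ℝ) (y : Fin (n - 4) → ℝ) (j : Fin 4) :
    ∫ x, ψ x * pd (fun z => h (s, z)) (assemble x y) (emb4 h4 j)
      = - ∫ x, fderiv ℝ ψ x (Pi.single j 1) * h (s, assemble x y) := by
  have hg : ContDiff ℝ ∞ (fun x => h (s, assemble x y)) :=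
    (contDiff_slice hh).comp (contDiff_const.prodMk (contDiff_const.prodMk contDiff_id))
  have hd : ∀ x, pd (fun z => h (s, z)) (assemble x y) (emb4 h4 j)
      = fderiv ℝ (fun x => h (s, assemble x y)) x (Pi.single j 1) := by
    intro x
    have h2 : HasFDerivAt (fun x' => assemble x' y)
        ((assembleL n).comp (ContinuousLinearMap.inl ℝ _ _)) x :=
      (assembleL n).hasFDerivAt.comp x (hasFDerivAt_prodMk_left x y)
    have d : Differentiable ℝ (fun z => h (s, z)) :=
      (hh.comp (contDiff_const.prodMk contDiff_id)).differentiable (by simp)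
    have h3 : HasFDerivAt (fun x' => h (s, assemble x' y)) _ x :=
      (d (assemble x y)).hasFDerivAt.comp (g := fun z => h (s, z)) x h2
    rw [h3.fderiv]
    simp [pd, assembleL_single_left h4]
  simp only [hd]
  have c1 : Continuous fun x => fderiv ℝ ψ x (Pi.single j 1) :=
    (hψ.continuous_fderiv (by simp)).clm_apply continuous_const
  have c2 : Continuous fun x => fderiv ℝ (fun x => h (s, assemble x y)) x (Pi.single j 1) :=
    (hg.continuous_fderiv (by simp)).clm_apply continuous_const
  refine integral_mul_fderiv_eq_neg_fderiv_mul_of_integrable ?_ ?_ ?_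
    (fun x _ => hψ.differentiable (by simp) x) (fun x _ => hg.differentiable (by simp) x)
  · exact (c1.mul hg.continuous).integrable_of_hasCompactSupport
      ((hψc.fderiv_apply ℝ _).mul_right)
  · exact (hψ.continuous.mul c2).integrable_of_hasCompactSupport hψc.mul_right
  · exact (hψ.continuous.mul hg.continuous).integrable_of_hasCompactSupport hψc.mul_right

theorem setIntegral_slice_mul_pd {h : ℝ × (Fin n → ℝ) → ℝ} (hh : ContDiff ℝ ∞ h)
    {ψ : (Fin 4 → ℝ) → ℝ} (hψ : ContDiff ℝ ∞ ψ) (hψc : HasCompactSupport ψ)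
    (h4 : 4 ≤ n) (a b : ℝ) (y : Fin (n - 4) → ℝ) (j : Fin 4) :
    ∫ p in Icc a b ×ˢ tsupport ψ,
        ψ p.2 * pd (fun z => h (p.1, z)) (assemble p.2 y) (emb4 h4 j)
      = - ∫ p in Icc a b ×ˢ tsupport ψ,
          fderiv ℝ ψ p.2 (Pi.single j 1) * h (p.1, assemble p.2 y) := by
  have c1 : Continuous fun x => fderiv ℝ ψ x (Pi.single j 1) :=
    (hψ.continuous_fderiv (by simp)).clm_apply continuous_const
  have c3 : Continuous fun p : ℝ × (Fin 4 → ℝ) => h (p.1, assemble p.2 y) :=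
    (contDiff_slice hh).continuous.comp (Continuous.prodMk_right y)
  have c4 : Continuous fun p : ℝ × (Fin 4 → ℝ) =>
      pd (fun z => h (p.1, z)) (assemble p.2 y) (emb4 h4 j) :=
    (contDiff_slice (pd_slice_contDiff hh (emb4 h4 j))).continuous.comp
      (Continuous.prodMk_right y)
  have i1 := integral_integral_eq_setIntegral (μ := volume)
    (u := fun s x => ψ x * pd (fun z => h (s, z)) (assemble x y) (emb4 h4 j)) hψc
    ((hψ.continuous.comp continuous_snd).mul c4)
    (fun s x hx => by simp [image_eq_zero_of_notMem_tsupport hx]) a b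
  have i2 := integral_integral_eq_setIntegral (μ := volume)
    (u := fun s x => fderiv ℝ ψ x (Pi.single j 1) * h (s, assemble x y)) hψc
    ((c1.comp continuous_snd).mul c3)
    (fun s x hx => by simp [fderiv_of_notMem_tsupport ℝ hx]) a b
  rw [Measure.volume_eq_prod, ← i1, ← i2, ← integral_neg]
  exact integral_congr_ae (ae_of_all _ fun s => integral_slice_mul_pd hh hψ hψc h4 s y j)

end SliceIntegrals

/-- (Slice-energy derivative identity along the singular directions.) -/
theorem slice_energy_derivative_identity
    (n k : ℕ) (hn : 5 ≤ n) (hk : 1 ≤ k)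
    (Γ : Conn n k) (hsm : IsSmoothConn Γ)
    (I' : Set ℝ) (hflow : IsYMFlowOn Γ I')
    (φ : (Fin 4 → ℝ) → ℝ) (hφ : ContDiff ℝ ∞ φ) (hφc : HasCompactSupport φ)
    (δ0 : ℝ) (hδ0 : 0 < δ0) (t : ℝ) (hI : Icc (t - δ0 ^ 2) t ⊆ I')
    (kb : Fin (n - 4)) (y : Fin (n - 4) → ℝ) :
    fderiv ℝ (fun y' : Fin (n - 4) → ℝ =>
        ∫ s in Icc (t - δ0 ^ 2) t, ∫ x : Fin 4 → ℝ,
          φ x ^ 2 * ∑ I, ∑ J,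
            trMul (curv Γ s (assemble x y') I J) (curv Γ s (assemble x y') I J))
      y (Pi.single kb 1)
    = 4 * (∫ s in Icc (t - δ0 ^ 2) t, ∫ x : Fin 4 → ℝ,
          ∑ I, trMul
            ((∑ j : Fin 4, fderiv ℝ (fun u => φ u ^ 2) x (Pi.single j 1) •
                curv Γ s (assemble x y) I (emb4 (by omega) j))
              - φ x ^ 2 • tderiv Γ s (assemble x y) I)
            (curv Γ s (assemble x y) (embB kb) I))
      - 4 * ∑ jb : Fin (n - 4),
          fderiv ℝ (fun y' : Fin (n - 4) → ℝ =>
              ∫ s in Icc (t - δ0 ^ 2) t, ∫ x : Fin 4 → ℝ,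
                φ x ^ 2 * ∑ I,
                  trMul (curv Γ s (assemble x y') I (embB jb))
                    (curv Γ s (assemble x y') (embB kb) I))
            y (Pi.single jb 1) := by
  have h4 : 4 ≤ n := by omega
  set K := embB kb
  set ψ : (Fin 4 → ℝ) → ℝ := fun u => φ u ^ 2
  have hψ : ContDiff ℝ ∞ ψ := hφ.pow 2
  have hψc : HasCompactSupport ψ := hφc.comp_left (g := fun r : ℝ => r ^ 2) (by simp)
  have htr : ∀ {v w : ℝ × (Fin n → ℝ) → Mat k}, ContDiff ℝ ∞ v → ContDiff ℝ ∞ w →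
      ContDiff ℝ ∞ (fun p => trMul (v p) (w p)) := fun hv hw =>
    ((trMulL k).contDiff.comp hv).clm_apply hw
  have hE : ContDiff ℝ ∞ (fun p : ℝ × (Fin n → ℝ) =>
      ∑ I, ∑ J, trMul (curv Γ p.1 p.2 I J) (curv Γ p.1 p.2 I J)) :=
    ContDiff.sum fun I _ => ContDiff.sum fun J _ => htr (hsm.curv I J) (hsm.curv I J)
  have hT : ∀ J, ContDiff ℝ ∞ (fun p : ℝ × (Fin n → ℝ) =>
      ∑ I, trMul (curv Γ p.1 p.2 I J) (curv Γ p.1 p.2 K I)) := fun J =>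
    ContDiff.sum fun I _ => htr (hsm.curv I J) (hsm.curv K I)
  have hW : ContDiff ℝ ∞ (fun p : ℝ × (Fin n → ℝ) =>
      ∑ I, trMul (tderiv Γ p.1 p.2 I) (curv Γ p.1 p.2 K I)) :=
    ContDiff.sum fun I _ => htr (hsm.tderiv I) (hsm.curv K I)
  have slice : ∀ {f : ℝ × (Fin n → ℝ) → ℝ}, ContDiff ℝ ∞ f →
      Continuous fun p : ℝ × (Fin 4 → ℝ) => f (p.1, assemble p.2 y) := fun hf =>
    (contDiff_slice hf).continuous.comp (Continuous.prodMk_right y)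
  have hψ2 : Continuous fun p : ℝ × (Fin 4 → ℝ) => ψ p.2 := hψ.continuous.comp continuous_snd
  have hdψ2 : ∀ j, Continuous fun p : ℝ × (Fin 4 → ℝ) => fderiv ℝ ψ p.2 (Pi.single j 1) :=
    fun j => ((hψ.continuous_fderiv (by simp)).clm_apply continuous_const).comp continuous_snd
  set Q := Icc (t - δ0 ^ 2) t ×ˢ tsupport ψ
  have hQc : IsCompact Q := isCompact_Icc.prod hψc
  have int : ∀ {f : ℝ × (Fin 4 → ℝ) → ℝ}, Continuous f → IntegrableOn f Q := fun hf =>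
    hf.continuousOn.integrableOn_compact hQc
  have hcT : ∀ J, Continuous fun p : ℝ × (Fin 4 → ℝ) => ψ p.2 *
      pd (fun z => ∑ I, trMul (curv Γ p.1 z I J) (curv Γ p.1 z K I)) (assemble p.2 y) J :=
    fun J => hψ2.mul (slice (pd_slice_contDiff (hT J) J))
  have hcW : Continuous fun p : ℝ × (Fin 4 → ℝ) => ψ p.2 *
      ∑ I, trMul (tderiv Γ p.1 (assemble p.2 y) I) (curv Γ p.1 (assemble p.2 y) K I) :=
    hψ2.mul (slice hW)
  have hcD : ∀ j : Fin 4, Continuous fun p : ℝ × (Fin 4 → ℝ) =>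
      fderiv ℝ ψ p.2 (Pi.single j 1) * ∑ I, trMul (curv Γ p.1 (assemble p.2 y) I (emb4 h4 j))
        (curv Γ p.1 (assemble p.2 y) K I) :=
    fun j => (hdψ2 j).mul (slice (hT (emb4 h4 j)))
  have hmid : ∀ s x, ∑ I, trMul
      ((∑ j : Fin 4, fderiv ℝ ψ x (Pi.single j 1) • curv Γ s (assemble x y) I (emb4 h4 j))
        - ψ x • tderiv Γ s (assemble x y) I) (curv Γ s (assemble x y) K I)
      = ∑ j : Fin 4, fderiv ℝ ψ x (Pi.single j 1) *
          ∑ I, trMul (curv Γ s (assemble x y) I (emb4 h4 j)) (curv Γ s (assemble x y) K I)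
        - ψ x * ∑ I, trMul (tderiv Γ s (assemble x y) I) (curv Γ s (assemble x y) K I) := by
    intro s x
    simp only [← trMulL_apply, map_sub, map_sum, map_smul, sub_apply, sum_apply, smul_apply,
      smul_eq_mul, Finset.sum_sub_distrib, Finset.mul_sum]
    rw [Finset.sum_comm]
  have hM : ∫ s in Icc (t - δ0 ^ 2) t, ∫ x : Fin 4 → ℝ, ∑ I, trMul
      ((∑ j : Fin 4, fderiv ℝ ψ x (Pi.single j 1) • curv Γ s (assemble x y) I (emb4 h4 j))
        - ψ x • tderiv Γ s (assemble x y) I) (curv Γ s (assemble x y) K I)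
      = ∫ p in Q, (∑ j : Fin 4, fderiv ℝ ψ p.2 (Pi.single j 1) *
          ∑ I, trMul (curv Γ p.1 (assemble p.2 y) I (emb4 h4 j))
            (curv Γ p.1 (assemble p.2 y) K I)
        - ψ p.2 * ∑ I, trMul (tderiv Γ p.1 (assemble p.2 y) I)
            (curv Γ p.1 (assemble p.2 y) K I)) := by
    simp only [hmid]
    exact integral_integral_eq_setIntegral (μ := volume) (u := fun s x =>
      ∑ j : Fin 4, fderiv ℝ ψ x (Pi.single j 1) *
          ∑ I, trMul (curv Γ s (assemble x y) I (emb4 h4 j)) (curv Γ s (assemble x y) K I)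
        - ψ x * ∑ I, trMul (tderiv Γ s (assemble x y) I) (curv Γ s (assemble x y) K I)) hψc
      ((continuous_finsetSum _ fun j _ => hcD j).sub hcW)
      (fun s x hx => by
        simp [image_eq_zero_of_notMem_tsupport hx, fderiv_of_notMem_tsupport ℝ hx]) _ _
  have hL := fderiv_slice_integral hE hψ hψc (t - δ0 ^ 2) t y kb
  have hR := fun jb => fderiv_slice_integral (hT (embB jb)) hψ hψc (t - δ0 ^ 2) t y jb
  have hP := fun j => setIntegral_slice_mul_pd (hT (emb4 h4 j)) hψ hψc h4 (t - δ0 ^ 2) t y j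
  refine hL.trans ?_
  rw [Finset.sum_congr rfl fun jb _ => hR jb]
  refine Eq.trans ?_ (congrArg (fun r => 4 * r - _) hM.symm)
  rw [integral_sub (int (continuous_finsetSum _ fun j _ => hcD j)) (int hcW),
    integral_finsetSum _ fun j _ => int (hcD j)]
  have hP' : ∀ j, ∫ p in Q, fderiv ℝ ψ p.2 (Pi.single j 1) *
      ∑ I, trMul (curv Γ p.1 (assemble p.2 y) I (emb4 h4 j)) (curv Γ p.1 (assemble p.2 y) K I)
      = - ∫ p in Q, ψ p.2 * pd (fun z => ∑ I, trMul (curv Γ p.1 z I (emb4 h4 j))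
          (curv Γ p.1 z K I)) (assemble p.2 y) (emb4 h4 j) := fun j => by
    rw [hP j, neg_neg]
  have hE' : ∫ p in Q, ψ p.2 * pd (fun z => ∑ I, ∑ J,
        trMul (curv Γ p.1 z I J) (curv Γ p.1 z I J)) (assemble p.2 y) K
      = ∫ p in Q, (-4 * (∑ J, ψ p.2 * pd (fun z => ∑ I, trMul (curv Γ p.1 z I J)
          (curv Γ p.1 z K I)) (assemble p.2 y) J)
        - 4 * (ψ p.2 * ∑ I, trMul (tderiv Γ p.1 (assemble p.2 y) I)
            (curv Γ p.1 (assemble p.2 y) K I))) := by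
    refine setIntegral_congr_fun hQc.measurableSet fun p hp => ?_
    rw [pd_energy_density hsm hflow (hI hp.1), ← Finset.mul_sum]
    ring
  rw [Finset.sum_congr rfl fun j _ => hP' j]
  refine hE'.trans ?_
  rw [integral_sub ((int (continuous_finsetSum _ fun J _ => hcT J)).const_mul _)
      ((int hcW).const_mul _), integral_const_mul, integral_const_mul,
    integral_finsetSum _ fun J _ => int (hcT J), sum_eq_sum_emb4_add_sum_embB h4,
    Finset.sum_neg_distrib]
  ring

end
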